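/- Let V : ℝ^d → ℝ be differentiable with L-Lipschitz gradient, let σ > 0 and x ∈ ℝ^d, and let u be a standard Gaussian random vector on ℝ^d (u ~ N(0, I_d)). Writing g_σ(x; u) := ((V(x+σu) − V(x))/σ)·u, the variance of the Gaussian-smoothing gradient estimate satisfies E_u[ | g_σ(x; u) − E_u[g_σ(x; u)] |² ] ≤ (σ²/2) L² (d+3)³ + 2(d+5) |∇V(x)|². -/

import Mathlib

open MeasureTheory Real

/-- The standard Gaussian measure `N(0, I_d)` on `ℝ^d`, given by its density
`(2π)^{-d/2} exp(-|u|²/2)` with respect to Lebesgue measure. -/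
noncomputable def stdGaussian (d : ℕ) : Measure (EuclideanSpace ℝ (Fin d)) :=
  volume.withDensity fun u =>
    ENNReal.ofReal ((2 * Real.pi) ^ (-(d : ℝ) / 2) * Real.exp (-‖u‖ ^ 2 / 2))


lemma gs_dens_int (d : ℕ) (k : ℕ) :
    Integrable (fun u : EuclideanSpace ℝ (Fin d) =>
      (‖u‖ ^ 2) ^ k * Real.exp (-‖u‖ ^ 2 / 2)) := by
  have h0 : Integrable (fun u : EuclideanSpace ℝ (Fin d) => Real.exp (-(1/4) * ‖u‖ ^ 2)) := by
    have h := GaussianFourier.integrable_cexp_neg_mul_sq_norm_add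
      (V := EuclideanSpace ℝ (Fin d)) (b := ((1/4 : ℝ) : ℂ)) (by norm_num) 0 0
    have h2 := h.norm
    refine h2.congr (Filter.Eventually.of_forall fun u => ?_)
    simp only [Complex.norm_exp]
    congr 1
    have : (-((1/4 : ℝ) : ℂ) * (‖u‖ : ℂ) ^ 2 + 0 * ((inner ℝ (0 : EuclideanSpace ℝ (Fin d)) u : ℝ) : ℂ))
      = ((-(1/4) * ‖u‖ ^ 2 : ℝ) : ℂ) := by push_cast; ring
    rw [this, Complex.ofReal_re]
  refine (h0.const_mul (4 ^ k * (k.factorial : ℝ))).mono' ?_ ?_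
  · exact (by fun_prop : Continuous _).aestronglyMeasurable
  · refine Filter.Eventually.of_forall fun u => ?_
    have h1 := Real.pow_div_factorial_le_exp (‖u‖ ^ 2 / 4) (by positivity) k
    rw [Real.norm_of_nonneg (by positivity)]
    have h2 : (‖u‖ ^ 2) ^ k ≤ 4 ^ k * (k.factorial : ℝ) * Real.exp (‖u‖ ^ 2 / 4) := by
      have hk : (0 : ℝ) < k.factorial := by positivity
      rw [div_le_iff₀ hk, div_pow, div_le_iff₀ (by positivity)] at h1
      linarith
    calc _ ≤ 4 ^ k * (k.factorial : ℝ) * Real.exp (‖u‖ ^ 2 / 4) * Real.exp (-‖u‖ ^ 2 / 2) := by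
          gcongr
      _ = _ := by rw [mul_assoc, ← Real.exp_add]; congr 2; ring

lemma gs_meas (d : ℕ) : Measurable fun u : EuclideanSpace ℝ (Fin d) =>
    ENNReal.ofReal ((2 * Real.pi) ^ (-(d : ℝ) / 2) * Real.exp (-‖u‖ ^ 2 / 2)) := by
  fun_prop

lemma gs_integral (d : ℕ) (f : EuclideanSpace ℝ (Fin d) → ℝ) :
    ∫ u, f u ∂(stdGaussian d) =
      (2 * Real.pi) ^ (-(d : ℝ) / 2) * ∫ u, f u * Real.exp (-‖u‖ ^ 2 / 2) := by
  rw [stdGaussian, integral_withDensity_eq_integral_toReal_smul (gs_meas d)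
    (Filter.Eventually.of_forall fun u => ENNReal.ofReal_lt_top), ← integral_const_mul]
  congr 1
  ext u
  rw [ENNReal.toReal_ofReal (by positivity), smul_eq_mul]
  ring

lemma gs_intgr (d : ℕ) {F : Type*} [NormedAddCommGroup F] [NormedSpace ℝ F]
    [SecondCountableTopology F]
    (f : EuclideanSpace ℝ (Fin d) → F) (hf : Continuous f) (C : ℝ) (k : ℕ)
    (hb : ∀ u, ‖f u‖ ≤ C * (1 + (‖u‖ ^ 2) ^ k)) : Integrable f (stdGaussian d) := by
  rw [stdGaussian, integrable_withDensity_iff_integrable_smul' (gs_meas d)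
    (Filter.Eventually.of_forall fun u => ENNReal.ofReal_lt_top)]
  refine ((((gs_dens_int d 0).add (gs_dens_int d k)).const_mul
    (C * (2 * Real.pi) ^ (-(d : ℝ) / 2)))).mono' ?_ (Filter.Eventually.of_forall fun u => ?_)
  · refine AEStronglyMeasurable.smul ?_ hf.aestronglyMeasurable
    exact ((gs_meas d).ennreal_toReal).aestronglyMeasurable
  · rw [ENNReal.toReal_ofReal (by positivity), norm_smul, Real.norm_of_nonneg (by positivity)]
    calc _ ≤ ((2 * Real.pi) ^ (-(d : ℝ) / 2) * Real.exp (-‖u‖ ^ 2 / 2)) *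
            (C * (1 + (‖u‖ ^ 2) ^ k)) := by gcongr; exact hb u
      _ = _ := by simp only [Pi.add_apply]; ring

lemma gs_one (d : ℕ) : ∫ _u, (1 : ℝ) ∂(stdGaussian d) = 1 := by
  rw [gs_integral]
  have h := GaussianFourier.integral_rexp_neg_mul_sq_norm (V := EuclideanSpace ℝ (Fin d))
    (b := 1/2) (by norm_num)
  have h2 : ∀ u : EuclideanSpace ℝ (Fin d),
      1 * Real.exp (-‖u‖ ^ 2 / 2) = Real.exp (-(1/2) * ‖u‖ ^ 2) := by
    intro u; rw [one_mul]; congr 1; ring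
  simp_rw [h2]
  rw [h, finrank_euclideanSpace, Fintype.card_fin,
    show π / (1/2) = 2 * π by ring, ← Real.rpow_add (by positivity)]
  rw [show -(d : ℝ) / 2 + d / 2 = 0 by ring, Real.rpow_zero]

instance gs_prob (d : ℕ) : IsProbabilityMeasure (stdGaussian d) := by
  have h := gs_one d
  rw [integral_const, smul_eq_mul, mul_one, measureReal_def] at h
  exact ⟨by rw [← ENNReal.toReal_eq_one_iff]; exact h⟩

lemma gs_pow_bound (t : ℝ) (ht : 0 ≤ t) (m k : ℕ) (h : m ≤ k) : t ^ m ≤ 1 + t ^ k := by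
  rcases le_total t 1 with h1 | h1
  · have := pow_le_one₀ (n := m) ht h1
    have : 0 ≤ t ^ k := by positivity
    linarith
  · have := pow_le_pow_right₀ h1 h
    linarith

/-- Integrability of the norm moments. -/
lemma gs_intM (d k : ℕ) : Integrable (fun u => (‖u‖ ^ 2) ^ k) (stdGaussian d) := by
  refine gs_intgr d _ (by fun_prop) 1 k fun u => ?_
  rw [Real.norm_of_nonneg (by positivity)]
  linarith

lemma gs_intA (d k : ℕ) (a : EuclideanSpace ℝ (Fin d)) :
    Integrable (fun u => (inner ℝ a u) ^ 2 * (‖u‖ ^ 2) ^ k) (stdGaussian d) := by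
  refine gs_intgr d _ (by fun_prop) (‖a‖ ^ 2) (k + 1) fun u => ?_
  rw [Real.norm_of_nonneg (by positivity)]
  have h : (inner ℝ a u) ^ 2 ≤ ‖a‖ ^ 2 * ‖u‖ ^ 2 := by
    rw [← mul_pow, ← sq_abs]
    gcongr
    exact abs_real_inner_le_norm a u
  calc _ ≤ ‖a‖ ^ 2 * ‖u‖ ^ 2 * (‖u‖ ^ 2) ^ k := by gcongr
    _ = ‖a‖ ^ 2 * (‖u‖ ^ 2) ^ (k + 1) := by ring
    _ ≤ _ := by gcongr; linarith

lemma gs_fderiv_exp (d : ℕ) (a u : EuclideanSpace ℝ (Fin d)) :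
    HasFDerivAt (fun u : EuclideanSpace ℝ (Fin d) => Real.exp (-‖u‖ ^ 2 / 2))
      (Real.exp (-‖u‖ ^ 2 / 2) • (-(innerSL ℝ u))) u := by
  have h := (hasStrictFDerivAt_norm_sq u).hasFDerivAt
  have h2 := ((h.const_mul (-1/2 : ℝ))).exp
  have e1 : (fun u : EuclideanSpace ℝ (Fin d) => Real.exp (-‖u‖ ^ 2 / 2)) =
      fun u => Real.exp (-1 / 2 * ‖u‖ ^ 2) := by
    ext v; congr 1; ring
  have e2 : Real.exp (-‖u‖ ^ 2 / 2) = Real.exp (-1 / 2 * ‖u‖ ^ 2) := by congr 1; ring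
  rw [e1, e2]
  refine h2.congr_fderiv ?_
  ext v
  simp only [ContinuousLinearMap.smul_apply, ContinuousLinearMap.neg_apply, innerSL_apply_apply,
    smul_eq_mul, nsmul_eq_mul]
  push_cast
  ring

lemma gs_fderiv_poly (d k : ℕ) (a u : EuclideanSpace ℝ (Fin d)) :
    HasFDerivAt (fun u : EuclideanSpace ℝ (Fin d) => inner ℝ a u * (‖u‖ ^ 2) ^ k)
      (inner ℝ a u • ((k * (‖u‖ ^ 2) ^ (k - 1)) • (2 • innerSL ℝ u)) +
        ((‖u‖ ^ 2) ^ k) • innerSL ℝ a) u := by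
  have h := ((hasStrictFDerivAt_norm_sq u).hasFDerivAt).pow k
  have h1 : HasFDerivAt (fun u : EuclideanSpace ℝ (Fin d) => inner ℝ a u) (innerSL ℝ a) u :=
    (innerSL ℝ a).hasFDerivAt
  refine (h1.mul h).congr_fderiv ?_
  rw [nsmul_eq_mul]

/-- Gaussian integration by parts. -/
lemma gs_ibp (d k : ℕ) (a : EuclideanSpace ℝ (Fin d)) :
    ∫ u, (inner ℝ a u) ^ 2 * (‖u‖ ^ 2) ^ k ∂(stdGaussian d) =
      ‖a‖ ^ 2 * ∫ u, (‖u‖ ^ 2) ^ k ∂(stdGaussian d) +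
      2 * k * ∫ u, (inner ℝ a u) ^ 2 * (‖u‖ ^ 2) ^ (k - 1) ∂(stdGaussian d) := by
  have hvol : ∀ f : EuclideanSpace ℝ (Fin d) → ℝ, Integrable f (stdGaussian d) →
      Integrable (fun u => f u * Real.exp (-‖u‖ ^ 2 / 2)) := by
    intro f hf
    rw [stdGaussian, integrable_withDensity_iff_integrable_smul' (gs_meas d)
      (Filter.Eventually.of_forall fun u => ENNReal.ofReal_lt_top)] at hf
    have hc : (0 : ℝ) < (2 * Real.pi) ^ (-(d : ℝ) / 2) := by positivity
    refine (hf.const_mul ((2 * Real.pi) ^ (-(d : ℝ) / 2))⁻¹).congr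
      (Filter.Eventually.of_forall fun u => ?_)
    simp only
    rw [ENNReal.toReal_ofReal (by positivity), smul_eq_mul]
    field_simp
  have hg' : ∀ u, fderiv ℝ (fun u : EuclideanSpace ℝ (Fin d) => Real.exp (-‖u‖ ^ 2 / 2)) u a
      = - (inner ℝ a u * Real.exp (-‖u‖ ^ 2 / 2)) := by
    intro u
    rw [(gs_fderiv_exp d a u).fderiv]
    simp [real_inner_comm, mul_comm]
  have hf' : ∀ u, fderiv ℝ (fun u : EuclideanSpace ℝ (Fin d) => inner ℝ a u * (‖u‖ ^ 2) ^ k) u a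
      = ‖a‖ ^ 2 * (‖u‖ ^ 2) ^ k + 2 * k * ((inner ℝ a u) ^ 2 * (‖u‖ ^ 2) ^ (k - 1)) := by
    intro u
    rw [(gs_fderiv_poly d k a u).fderiv]
    simp only [ContinuousLinearMap.add_apply, ContinuousLinearMap.smul_apply, innerSL_apply_apply,
      smul_eq_mul, real_inner_self_eq_norm_sq, nsmul_eq_mul]
    rw [real_inner_comm a u]
    push_cast
    ring
  have hsum : Integrable (fun u => ‖a‖ ^ 2 * (‖u‖ ^ 2) ^ k +
      2 * k * ((inner ℝ a u) ^ 2 * (‖u‖ ^ 2) ^ (k - 1))) (stdGaussian d) :=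
    ((gs_intM d k).const_mul _).add ((gs_intA d (k-1) a).const_mul _)
  have hlin : Integrable (fun u => inner ℝ a u * (‖u‖ ^ 2) ^ k) (stdGaussian d) := by
    refine gs_intgr d _ (by fun_prop) (2 * ‖a‖) (k + 1) fun u => ?_
    rw [norm_mul, Real.norm_of_nonneg (by positivity : 0 ≤ (‖u‖ ^ 2) ^ k)]
    have h1 : ‖u‖ ≤ 1 + ‖u‖ ^ 2 := by nlinarith [sq_nonneg (‖u‖ - 1), norm_nonneg u]
    have h2 := gs_pow_bound (‖u‖ ^ 2) (by positivity) k (k + 1) (by omega)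
    calc _ ≤ (‖a‖ * ‖u‖) * (‖u‖ ^ 2) ^ k := by
          gcongr
          exact norm_inner_le_norm a u
      _ ≤ (‖a‖ * (1 + ‖u‖ ^ 2)) * (‖u‖ ^ 2) ^ k := by gcongr
      _ = ‖a‖ * ((‖u‖ ^ 2) ^ k + (‖u‖ ^ 2) ^ (k + 1)) := by ring
      _ ≤ ‖a‖ * (2 * (1 + (‖u‖ ^ 2) ^ (k + 1))) := by
          gcongr
          linarith
      _ = _ := by ring
  have key := integral_mul_fderiv_eq_neg_fderiv_mul_of_integrable
    (μ := (volume : Measure (EuclideanSpace ℝ (Fin d)))) (𝕜 := ℝ)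
    (f := fun u : EuclideanSpace ℝ (Fin d) => inner ℝ a u * (‖u‖ ^ 2) ^ k)
    (g := fun u : EuclideanSpace ℝ (Fin d) => Real.exp (-‖u‖ ^ 2 / 2)) (v := a)
    (by simp_rw [hf']; exact hvol _ hsum)
    (by
      simp_rw [hg']
      refine (hvol _ (gs_intA d k a)).neg.congr (Filter.Eventually.of_forall fun u => ?_)
      simp only [Pi.neg_apply]
      ring)
    (hvol _ hlin)
    (fun u _ => (gs_fderiv_poly d k a u).differentiableAt)
    (fun u _ => (gs_fderiv_exp d a u).differentiableAt)
  simp_rw [hf', hg'] at key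
  rw [← integral_const_mul, ← integral_const_mul, ← integral_add
    ((gs_intM d k).const_mul _) ((gs_intA d (k-1) a).const_mul _), gs_integral, gs_integral]
  congr 1
  rw [← neg_inj, ← key, ← integral_neg]
  congr 1
  ext u
  ring

lemma gs_M_succ (d k : ℕ) :
    ∫ u, (‖u‖ ^ 2) ^ (k + 1) ∂(stdGaussian d) =
      (d + 2 * k) * ∫ u, (‖u‖ ^ 2) ^ k ∂(stdGaussian d) := by
  have hs : ∀ (m : ℕ), ∫ u, (‖u‖ ^ 2) ^ (m + 1) ∂(stdGaussian d) =
      ∑ i : Fin d, ∫ u, (inner ℝ (EuclideanSpace.basisFun (Fin d) ℝ i) u) ^ 2 * (‖u‖ ^ 2) ^ m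
        ∂(stdGaussian d) := by
    intro m
    rw [← integral_finsetSum _ fun i _ => gs_intA d m _]
    congr 1
    ext u
    rw [← Finset.sum_mul, pow_succ, mul_comm]
    congr 1
    rw [EuclideanSpace.norm_sq_eq]
    simp [EuclideanSpace.inner_single_left]
  rw [hs]
  simp_rw [gs_ibp d k]
  rw [Finset.sum_add_distrib, ← Finset.mul_sum]
  simp only [OrthonormalBasis.norm_eq_one, one_pow, one_mul, Finset.sum_const, Finset.card_univ,
    Fintype.card_fin, nsmul_eq_mul]
  rcases k with _ | k
  · simp
  · rw [Nat.add_sub_cancel, ← hs]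
    ring

lemma gs_M3 (d : ℕ) : ∫ u, (‖u‖ ^ 2) ^ 3 ∂(stdGaussian d) = d * (d + 2) * (d + 4) := by
  have h0 : ∫ u, (‖u‖ ^ 2) ^ 0 ∂(stdGaussian d) = 1 := by simp
  rw [gs_M_succ, gs_M_succ, gs_M_succ, h0]
  push_cast
  ring

lemma gs_A1 (d : ℕ) (a : EuclideanSpace ℝ (Fin d)) :
    ∫ u, (inner ℝ a u) ^ 2 * (‖u‖ ^ 2) ^ 1 ∂(stdGaussian d) = (d + 2) * ‖a‖ ^ 2 := by
  have h0 : ∫ u, (‖u‖ ^ 2) ^ 0 ∂(stdGaussian d) = 1 := by simp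
  rw [gs_ibp, gs_M_succ, h0, Nat.sub_self, gs_ibp, h0]
  push_cast
  ring

lemma gs_taylor (d : ℕ) (V : EuclideanSpace ℝ (Fin d) → ℝ)
    (hV : Differentiable ℝ V) (L : ℝ)
    (hlip : ∀ x y, ‖gradient V x - gradient V y‖ ≤ L * ‖x - y‖)
    (x h : EuclideanSpace ℝ (Fin d)) :
    |V (x + h) - V x - inner ℝ (gradient V x) h| ≤ L / 2 * ‖h‖ ^ 2 := by
  have hd : ∀ t : ℝ, HasDerivAt (fun t : ℝ => V (x + t • h) - V x - t * inner ℝ (gradient V x) h)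
      (inner ℝ (gradient V (x + t • h) - gradient V x) h) t := by
    intro t
    have h1 : HasDerivAt (fun t : ℝ => x + t • h) h t := by
      simpa using ((hasDerivAt_id t).smul_const h).const_add x
    have h2 := ((hV (x + t • h)).hasGradientAt.hasFDerivAt).comp_hasDerivAt t h1
    have h3 := (h2.sub_const (V x)).sub ((hasDerivAt_id t).mul_const (inner ℝ (gradient V x) h))
    refine h3.congr_deriv ?_
    simp [inner_sub_left]
  have hB : ∀ t : ℝ, HasDerivAt (fun t : ℝ => L / 2 * ‖h‖ ^ 2 * t ^ 2) (L * ‖h‖ ^ 2 * t) t := by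
    intro t
    have := (hasDerivAt_pow 2 t).const_mul (L / 2 * ‖h‖ ^ 2)
    refine this.congr_deriv ?_
    norm_num
    ring
  have := image_norm_le_of_norm_deriv_right_le_deriv_boundary (a := 0) (b := 1)
    (f := fun t : ℝ => V (x + t • h) - V x - t * inner ℝ (gradient V x) h)
    (fun t _ => (hd t).continuousAt.continuousWithinAt)
    (fun t _ => (hd t).hasDerivWithinAt) (by simp) hB
    (by
      intro t ht
      calc _ ≤ ‖gradient V (x + t • h) - gradient V x‖ * ‖h‖ := norm_inner_le_norm _ _
        _ ≤ (L * ‖x + t • h - x‖) * ‖h‖ := by gcongr; exact hlip _ _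
        _ = _ := by
          rw [add_sub_cancel_left, norm_smul, Real.norm_of_nonneg ht.1]; ring)
    (Set.right_mem_Icc.2 zero_le_one)
  simpa using this

lemma gs_var (d : ℕ) (g : EuclideanSpace ℝ (Fin d) → EuclideanSpace ℝ (Fin d))
    (hg : Integrable g (stdGaussian d)) (hg2 : Integrable (fun u => ‖g u‖ ^ 2) (stdGaussian d)) :
    ∫ u, ‖g u - ∫ w, g w ∂(stdGaussian d)‖ ^ 2 ∂(stdGaussian d) ≤
      ∫ u, ‖g u‖ ^ 2 ∂(stdGaussian d) := by
  set m := ∫ w, g w ∂(stdGaussian d) with hm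
  have hi : Integrable (fun u => inner ℝ m (g u)) (stdGaussian d) := hg.const_inner m
  have h1 : ∫ u, inner ℝ m (g u) ∂(stdGaussian d) = ‖m‖ ^ 2 := by
    rw [integral_inner hg m, ← hm, real_inner_self_eq_norm_sq]
  have h2 : ∀ u, ‖g u - m‖ ^ 2 = ‖g u‖ ^ 2 - 2 * inner ℝ m (g u) + ‖m‖ ^ 2 := by
    intro u
    rw [norm_sub_sq_real, real_inner_comm]
  simp_rw [h2]
  have h3 : Integrable (fun u => ‖g u‖ ^ 2 - 2 * inner ℝ m (g u)) (stdGaussian d) :=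
    hg2.sub (hi.const_mul 2)
  rw [integral_add h3 (integrable_const _),
    integral_sub hg2 (hi.const_mul 2), integral_const_mul, h1, integral_const]
  simp
  nlinarith [sq_nonneg ‖m‖]

/-- Variance bound for the Gaussian-smoothing gradient estimator
`g_σ(x; u) = ((V(x+σu) − V(x))/σ) u`: if `V` has `L`-Lipschitz gradient, then
`E_u[|g_σ(x;u) − E_u[g_σ(x;u)]|²] ≤ (σ²/2) L² (d+3)³ + 2(d+5)|∇V(x)|²`. -/
theorem gaussian_smoothing_variance_bound
    (d : ℕ) (V : EuclideanSpace ℝ (Fin d) → ℝ)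
    (hV : Differentiable ℝ V)
    (L : ℝ) (hL : 0 < L)
    (hlip : ∀ x y, ‖gradient V x - gradient V y‖ ≤ L * ‖x - y‖)
    (σ : ℝ) (hσ : 0 < σ) (x : EuclideanSpace ℝ (Fin d)) :
    (∫ u, ‖((V (x + σ • u) - V x) / σ) • u -
        (∫ w, ((V (x + σ • w) - V x) / σ) • w ∂(stdGaussian d))‖ ^ 2 ∂(stdGaussian d))
      ≤ σ ^ 2 / 2 * L ^ 2 * ((d : ℝ) + 3) ^ 3 + 2 * ((d : ℝ) + 5) * ‖gradient V x‖ ^ 2 := by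
  set G := gradient V x with hG
  set g : EuclideanSpace ℝ (Fin d) → EuclideanSpace ℝ (Fin d) :=
    fun u => ((V (x + σ • u) - V x) / σ) • u with hgdef
  have hVc := hV.continuous
  have hgc : Continuous g := by
    simp only [hgdef]
    fun_prop
  have hpt : ∀ u, ‖g u‖ ^ 2 ≤ 2 * ((inner ℝ G u) ^ 2 * (‖u‖ ^ 2) ^ 1) +
      σ ^ 2 / 2 * L ^ 2 * (‖u‖ ^ 2) ^ 3 := by
    intro u
    have h := gs_taylor d V hV L hlip x (σ • u)
    rw [← hG, inner_smul_right, norm_smul, Real.norm_of_nonneg hσ.le] at h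
    set r := V (x + σ • u) - V x - σ * inner ℝ G u with hr
    have hr2 : (r / σ) ^ 2 ≤ (L / 2 * σ * ‖u‖ ^ 2) ^ 2 := by
      rw [← sq_abs]
      gcongr
      rw [abs_div, abs_of_pos hσ, div_le_iff₀ hσ]
      linarith
    have hq : (V (x + σ • u) - V x) / σ = inner ℝ G u + r / σ := by
      rw [hr]; field_simp; ring
    simp only [hgdef]
    rw [norm_smul, mul_pow, Real.norm_eq_abs, sq_abs, hq]
    have h3 : (inner ℝ G u + r / σ) ^ 2 ≤
        2 * (inner ℝ G u) ^ 2 + 2 * (L / 2 * σ * ‖u‖ ^ 2) ^ 2 := by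
      nlinarith [sq_nonneg (inner ℝ G u - r / σ)]
    calc _ ≤ (2 * (inner ℝ G u) ^ 2 + 2 * (L / 2 * σ * ‖u‖ ^ 2) ^ 2) * ‖u‖ ^ 2 := by gcongr
      _ = _ := by ring
  have hI : Integrable (fun u => 2 * ((inner ℝ G u) ^ 2 * (‖u‖ ^ 2) ^ 1) +
      σ ^ 2 / 2 * L ^ 2 * (‖u‖ ^ 2) ^ 3) (stdGaussian d) :=
    ((gs_intA d 1 G).const_mul _).add ((gs_intM d 3).const_mul _)
  have hg2 : Integrable (fun u => ‖g u‖ ^ 2) (stdGaussian d) := by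
    refine hI.mono' (by fun_prop : Continuous _).aestronglyMeasurable
      (Filter.Eventually.of_forall fun u => ?_)
    rw [Real.norm_of_nonneg (by positivity)]
    exact hpt u
  have hg1 : Integrable g (stdGaussian d) := by
    refine (hg2.add (integrable_const (1 : ℝ))).mono' hgc.aestronglyMeasurable
      (Filter.Eventually.of_forall fun u => ?_)
    simp only [Pi.add_apply]
    nlinarith [sq_nonneg (‖g u‖ - 1), norm_nonneg (g u)]
  refine (gs_var d g hg1 hg2).trans ((integral_mono hg2 hI hpt).trans ?_)
  rw [integral_add ((gs_intA d 1 G).const_mul _) ((gs_intM d 3).const_mul _),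
    integral_const_mul, integral_const_mul, gs_A1, gs_M3]
  have hd : (0 : ℝ) ≤ d := Nat.cast_nonneg d
  have e1 : (d : ℝ) * (d + 2) * (d + 4) ≤ (d + 3) ^ 3 := by nlinarith [mul_nonneg hd hd]
  have e2 : σ ^ 2 / 2 * L ^ 2 * ((d : ℝ) * (d + 2) * (d + 4)) ≤
      σ ^ 2 / 2 * L ^ 2 * ((d : ℝ) + 3) ^ 3 := by gcongr
  nlinarith [sq_nonneg ‖G‖]
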